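/- For any A∞-structure m on V and all homogeneous A, B, C ∈ W the following cochain identity holds: [A, M_2(B,C)] − (−1)^{|A|} M_2([A,B], C) − (−1)^{|A|(|B|+1)} M_2(B, [A,C]) = (−1)^{|A|} ( M_1(A{B,C}) − M_1(A){B,C} − (−1)^{|A|} A{M_1(B), C} − (−1)^{|A|+|B|} A{B, M_1(C)} ). In particular, if A, B, C are M_1-cocycles, then [A, M_2(B,C)] − (−1)^{|A|} M_2([A,B], C) − (−1)^{|A|(|B|+1)} M_2(B, [A,C]) is an M_1-coboundary, so on M_1-cohomology the cup product a∪b := (−1)^{|A|−1}[M_2(A,B)] and the induced Gerstenhaber bracket satisfy the graded Poisson relation [a, b∪c] = [a,b]∪c + (−1)^{|a|(|b|+1)} b∪[a,c]. -/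

import Mathlib

namespace Ainf

variable (k : Type*) [Field k] [CharZero k]
variable (V : ℤ → Type*) [∀ l, AddCommGroup (V l)] [∀ l, Module k (V l)]

/-- Homogeneous elements of `V`, tagged with their degree. -/
abbrev HV := Σ l : ℤ, V l

/-- Total degree of a list of homogeneous elements. -/
def degSum (vs : List (HV V)) : ℤ := (vs.map Sigma.fst).sum

/-- Cast between homogeneous components (junk value `0` if the degrees differ;
in all intended uses the degrees provably agree). -/
def vcast {a b : ℤ} (x : V a) : V b := if h : a = b then h ▸ x else 0

/-- A homogeneous degree-`d` element of `Hom(T(V),V)`, encoded by its values on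
tuples (lists) of homogeneous elements of `V`. -/
abbrev E (d : ℤ) := (vs : List (HV V)) → V (d + degSum V vs)

/-- Multilinearity (over `k`, in each slot) of a graded map: this singles out the
elements of `W = Hom(T(V),V)` among all functions on homogeneous tuples. -/
def IsMultilinear {d : ℤ} (f : E V d) : Prop :=
  (∀ (xs zs : List (HV V)) (l : ℤ) (x y : V l),
      (vcast V (f (xs ++ ⟨l, x + y⟩ :: zs)) : V (d + degSum V xs + l + degSum V zs)) =
        vcast V (f (xs ++ ⟨l, x⟩ :: zs)) + vcast V (f (xs ++ ⟨l, y⟩ :: zs))) ∧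
  (∀ (xs zs : List (HV V)) (l : ℤ) (c : k) (x : V l),
      (vcast V (f (xs ++ ⟨l, c • x⟩ :: zs)) : V (d + degSum V xs + l + degSum V zs)) =
        c • vcast V (f (xs ++ ⟨l, x⟩ :: zs)))

/-- All splittings of a list into two consecutive parts. -/
def splits2 {α : Type*} (vs : List α) : List (List α × List α) :=
  (List.range (vs.length + 1)).map fun i => (vs.take i, vs.drop i)

/-- All splittings of a list into three consecutive parts. -/
def splits3 {α : Type*} (vs : List α) : List (List α × List α × List α) :=
  (splits2 vs).flatMap fun p => (splits2 p.2).map fun q => (p.1, q.1, q.2)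

/-- The Gerstenhaber composition product
`(f∘g)(v₁,…) = Σᵢ (−1)^{|g|(|v₁|+⋯+|vᵢ|)} f(v₁,…,vᵢ,g(v_{i+1},…),…)`. -/
def gcomp {a b : ℤ} (f : E V a) (g : E V b) : E V (a + b) := fun vs =>
  ((splits3 vs).map fun p =>
    ((-1 : k) ^ (b * degSum V p.1)) •
      vcast V (f (p.1 ++ ⟨b + degSum V p.2.1, g p.2.1⟩ :: p.2.2))).sum

/-- Degree recast of a graded map (junk when the degrees differ). -/
def recast {a b : ℤ} (f : E V a) : E V b := fun vs => vcast V (f vs)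

/-- The Gerstenhaber bracket `[f,g] = f∘g − (−1)^{|f||g|} g∘f`. -/
def gbr {a b : ℤ} (f : E V a) (g : E V b) : E V (a + b) :=
  gcomp k V f g - ((-1 : k) ^ (a * b)) • recast V (gcomp k V g f)

/-- A homogeneous element of `W`, packaged with its degree. -/
abbrev GE := Σ d : ℤ, E V d

/-- Total degree of a list of homogeneous elements of `W`. -/
def degl (As : List (GE V)) : ℤ := (As.map Sigma.fst).sum

/-- Auxiliary enumeration of all ordered disjoint insertions of the operations `Bs`
into a tuple `vs`, together with the Koszul sign exponents
`ε = Σᵢ |Bᵢ|(|v₁|+⋯+|v_{kᵢ}|)`. -/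
def ins : List (GE V) → List (HV V) → List (ℤ × List (HV V))
  | [], vs => [(0, vs)]
  | B :: Bs, vs =>
    (splits3 vs).flatMap fun p =>
      (ins Bs p.2.2).map fun q =>
        (B.1 * degSum V p.1 + degl V Bs * (degSum V p.1 + degSum V p.2.1) + q.1,
          p.1 ++ ⟨B.1 + degSum V p.2.1, B.2 p.2.1⟩ :: q.2)

/-- The brace operations `A{A₁,…,Aₚ}`. -/
def braces {a : ℤ} (A : E V a) (As : List (GE V)) : E V (a + degl V As) := fun vs =>
  ((ins V As vs).map fun q => ((-1 : k) ^ q.1) • vcast V (A q.2)).sum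

/-- The first derived map `M₁(A) = m∘A − (−1)^{|A|} A∘m`. -/
def M1 (m : E V 1) {a : ℤ} (A : E V a) : E V (a + 1) :=
  recast V (gcomp k V m A) - ((-1 : k) ^ a) • recast V (gcomp k V A m)

/-- The second derived map `M₂(A,B) = m{A,B}`. -/
def M2 (m : E V 1) {a b : ℤ} (A : E V a) (B : E V b) : E V (a + b + 1) :=
  recast V (braces k V m [⟨a, A⟩, ⟨b, B⟩])

/-- The cup product representative `A ∪ B = (−1)^{|A|−1} M₂(A,B)` on cochains. -/
def cup (m : E V 1) {a b : ℤ} (A : E V a) (B : E V b) : E V (a + b + 1) :=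
  ((-1 : k) ^ (a - 1)) • M2 k V m A B

set_option linter.unusedSectionVars false

section SplittingSums

variable {α M N : Type*} [AddCommGroup M] [AddCommGroup N]

/-- Sum over all splittings of a list into two consecutive parts. -/
def sum2 (vs : List α) (F : List α → List α → M) : M :=
  ((splits2 vs).map fun p => F p.1 p.2).sum

/-- Sum over all splittings of a list into three consecutive parts. -/
def sum3 (vs : List α) (F : List α → List α → List α → M) : M :=
  sum2 vs fun p₁ r => sum2 r fun p₂ p₃ => F p₁ p₂ p₃

/-- Sum over all splittings of a list into four consecutive parts. -/
def sum4 (vs : List α) (F : List α → List α → List α → List α → M) : M :=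
  sum2 vs fun p₁ r₁ => sum2 r₁ fun p₂ r₂ => sum2 r₂ fun p₃ p₄ => F p₁ p₂ p₃ p₄

/-- Sum over all splittings of a list into five consecutive parts. -/
def sum5 (vs : List α) (F : List α → List α → List α → List α → List α → M) : M :=
  sum2 vs fun p₁ r₁ => sum2 r₁ fun p₂ r₂ => sum2 r₂ fun p₃ r₃ => sum2 r₃ fun p₄ p₅ =>
    F p₁ p₂ p₃ p₄ p₅

/-- Sum over all splittings of a list into six consecutive parts. -/
def sum6 (vs : List α)
    (F : List α → List α → List α → List α → List α → List α → M) : M :=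
  sum2 vs fun p₁ r₁ => sum2 r₁ fun p₂ r₂ => sum2 r₂ fun p₃ r₃ => sum2 r₃ fun p₄ r₄ =>
    sum2 r₄ fun p₅ p₆ => F p₁ p₂ p₃ p₄ p₅ p₆

/-- Sum over all splittings of a list into seven consecutive parts. -/
def sum7 (vs : List α)
    (F : List α → List α → List α → List α → List α → List α → List α → M) : M :=
  sum2 vs fun p₁ r₁ => sum2 r₁ fun p₂ r₂ => sum2 r₂ fun p₃ r₃ => sum2 r₃ fun p₄ r₄ =>
    sum2 r₄ fun p₅ r₅ => sum2 r₅ fun p₆ p₇ => F p₁ p₂ p₃ p₄ p₅ p₆ p₇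

theorem sum2_nil (F : List α → List α → M) : sum2 [] F = F [] [] := by
  simp [sum2, splits2]

theorem sum2_cons (v : α) (vs : List α) (F : List α → List α → M) :
    sum2 (v :: vs) F = F [] (v :: vs) + sum2 vs fun p q => F (v :: p) q := by
  simp [sum2, splits2, List.range_succ_eq_map, Function.comp_def]

theorem sum2_add (vs : List α) (F G : List α → List α → M) :
    (sum2 vs fun p q => F p q + G p q) = sum2 vs F + sum2 vs G :=
  List.sum_map_add

theorem map_sum2 {φ : Type*} [FunLike φ M N] [AddMonoidHomClass φ M N] (L : φ)
    (vs : List α) (F : List α → List α → M) :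
    L (sum2 vs F) = sum2 vs fun p q => L (F p q) := by
  simp [sum2, map_list_sum, Function.comp_def]

theorem sum2_comm (us vs : List α) (F : List α → List α → List α → List α → M) :
    (sum2 us fun p q => sum2 vs fun s t => F p q s t) =
      sum2 vs fun s t => sum2 us fun p q => F p q s t := by
  induction us generalizing F with
  | nil => simp [sum2_nil]
  | cons u us ih => simp only [sum2_cons, sum2_add, ih]

theorem sum3_comm (us vs : List α)
    (F : List α → List α → List α → List α → List α → M) :
    (sum3 us fun p q r => sum2 vs fun s t => F p q r s t) =
      sum2 vs fun s t => sum3 us fun p q r => F p q r s t := by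
  simp only [sum3, sum2_comm _ vs]

theorem sum4_comm (us vs : List α)
    (F : List α → List α → List α → List α → List α → List α → M) :
    (sum4 us fun p q r u => sum2 vs fun s t => F p q r u s t) =
      sum2 vs fun s t => sum4 us fun p q r u => F p q r u s t := by
  simp only [sum4, sum2_comm _ vs]

/-- Splitting the first part of a splitting again. -/
theorem sum2_refine₁ (vs : List α) (F : List α → List α → List α → List α → M) :
    (sum2 vs fun p q => sum2 p fun s t => F p s t q) =
      sum3 vs fun s t q => F (s ++ t) s t q := by
  unfold sum3
  induction vs generalizing F with
  | nil => simp [sum2_nil]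
  | cons v vs ih =>
    simp only [sum2_cons, sum2_nil, sum2_add, List.nil_append, List.cons_append]
    rw [ih fun p s t q => F (v :: p) (v :: s) t q]
    abel

/-- The marked letter `x` of a list lies either in the second or in the first part of a
splitting. -/
theorem sum2_append_cons (xs zs : List α) (x : α) (F : List α → List α → M) :
    sum2 (xs ++ x :: zs) F =
      (sum2 xs fun s t => F s (t ++ x :: zs)) + sum2 zs fun s t => F (xs ++ x :: s) t := by
  induction xs generalizing F with
  | nil => simp [sum2_nil, sum2_cons]
  | cons v xs ih => simp only [List.cons_append, sum2_cons, ih, add_assoc]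

theorem sum2_congr {vs : List α} {F G : List α → List α → M}
    (h : ∀ p q, p ++ q = vs → F p q = G p q) : sum2 vs F = sum2 vs G := by
  induction vs generalizing F G with
  | nil => simp [sum2_nil, h]
  | cons v vs ih =>
    rw [sum2_cons, sum2_cons, h _ _ rfl, ih fun p q e => h _ _ (by simp [e])]

theorem sum2_refine₂ (vs : List α) (F : List α → List α → List α → List α → M) :
    (sum2 vs fun p q => sum2 q fun s t => F p q s t) =
      sum3 vs fun p s t => F p (s ++ t) s t :=
  sum2_congr fun p q _ => sum2_congr fun s t e => by simp only [e]

theorem sum3_refine₁ (vs : List α)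
    (F : List α → List α → List α → List α → List α → M) :
    (sum3 vs fun p₁ p₂ p₃ => sum2 p₁ fun s t => F p₁ s t p₂ p₃) =
      sum4 vs fun s t p₂ p₃ => F (s ++ t) s t p₂ p₃ :=
  (sum2_congr fun p₁ r _ => sum2_comm r p₁ _).trans
    (sum2_refine₁ vs fun p₁ s t r => sum2 r fun p₂ p₃ => F p₁ s t p₂ p₃)

theorem sum3_refine₂ (vs : List α)
    (F : List α → List α → List α → List α → List α → M) :
    (sum3 vs fun p₁ p₂ p₃ => sum2 p₂ fun s t => F p₁ p₂ s t p₃) =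
      sum4 vs fun p₁ s t p₃ => F p₁ (s ++ t) s t p₃ :=
  sum2_congr fun _ _ _ => sum2_refine₁ _ _

theorem sum3_refine₃ (vs : List α)
    (F : List α → List α → List α → List α → List α → M) :
    (sum3 vs fun p₁ p₂ p₃ => sum2 p₃ fun s t => F p₁ p₂ p₃ s t) =
      sum4 vs fun p₁ p₂ s t => F p₁ p₂ (s ++ t) s t :=
  sum2_congr fun _ _ _ => sum2_refine₂ _ _

theorem sum4_refine₁ (vs : List α)
    (F : List α → List α → List α → List α → List α → List α → M) :
    (sum4 vs fun p₁ p₂ p₃ p₄ => sum2 p₁ fun s t => F p₁ s t p₂ p₃ p₄) =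
      sum5 vs fun s t p₂ p₃ p₄ => F (s ++ t) s t p₂ p₃ p₄ :=
  (sum2_congr fun p₁ r _ => sum3_comm r p₁ _).trans
    (sum2_refine₁ vs fun p₁ s t r => sum3 r fun p₂ p₃ p₄ => F p₁ s t p₂ p₃ p₄)

theorem sum4_refine₂ (vs : List α)
    (F : List α → List α → List α → List α → List α → List α → M) :
    (sum4 vs fun p₁ p₂ p₃ p₄ => sum2 p₂ fun s t => F p₁ p₂ s t p₃ p₄) =
      sum5 vs fun p₁ s t p₃ p₄ => F p₁ (s ++ t) s t p₃ p₄ :=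
  sum2_congr fun _ _ _ => sum3_refine₁ _ _

theorem sum4_refine₃ (vs : List α)
    (F : List α → List α → List α → List α → List α → List α → M) :
    (sum4 vs fun p₁ p₂ p₃ p₄ => sum2 p₃ fun s t => F p₁ p₂ p₃ s t p₄) =
      sum5 vs fun p₁ p₂ s t p₄ => F p₁ p₂ (s ++ t) s t p₄ :=
  sum2_congr fun _ _ _ => sum3_refine₂ _ _

theorem sum4_refine₄ (vs : List α)
    (F : List α → List α → List α → List α → List α → List α → M) :
    (sum4 vs fun p₁ p₂ p₃ p₄ => sum2 p₄ fun s t => F p₁ p₂ p₃ p₄ s t) =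
      sum5 vs fun p₁ p₂ p₃ s t => F p₁ p₂ p₃ (s ++ t) s t :=
  sum2_congr fun _ _ _ => sum3_refine₃ _ _

theorem sum5_refine₁ (vs : List α)
    (F : List α → List α → List α → List α → List α → List α → List α → M) :
    (sum5 vs fun p₁ p₂ p₃ p₄ p₅ => sum2 p₁ fun s t => F p₁ s t p₂ p₃ p₄ p₅) =
      sum6 vs fun s t p₂ p₃ p₄ p₅ => F (s ++ t) s t p₂ p₃ p₄ p₅ :=
  (sum2_congr fun p₁ r _ => sum4_comm r p₁ _).trans
    (sum2_refine₁ vs fun p₁ s t r => sum4 r fun p₂ p₃ p₄ p₅ => F p₁ s t p₂ p₃ p₄ p₅)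

theorem sum5_refine₂ (vs : List α)
    (F : List α → List α → List α → List α → List α → List α → List α → M) :
    (sum5 vs fun p₁ p₂ p₃ p₄ p₅ => sum2 p₂ fun s t => F p₁ p₂ s t p₃ p₄ p₅) =
      sum6 vs fun p₁ s t p₃ p₄ p₅ => F p₁ (s ++ t) s t p₃ p₄ p₅ :=
  sum2_congr fun _ _ _ => sum4_refine₁ _ _

theorem sum5_refine₃ (vs : List α)
    (F : List α → List α → List α → List α → List α → List α → List α → M) :
    (sum5 vs fun p₁ p₂ p₃ p₄ p₅ => sum2 p₃ fun s t => F p₁ p₂ p₃ s t p₄ p₅) =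
      sum6 vs fun p₁ p₂ s t p₄ p₅ => F p₁ p₂ (s ++ t) s t p₄ p₅ :=
  sum2_congr fun _ _ _ => sum4_refine₂ _ _

theorem sum5_refine₄ (vs : List α)
    (F : List α → List α → List α → List α → List α → List α → List α → M) :
    (sum5 vs fun p₁ p₂ p₃ p₄ p₅ => sum2 p₄ fun s t => F p₁ p₂ p₃ p₄ s t p₅) =
      sum6 vs fun p₁ p₂ p₃ s t p₅ => F p₁ p₂ p₃ (s ++ t) s t p₅ :=
  sum2_congr fun _ _ _ => sum4_refine₃ _ _

theorem sum5_refine₅ (vs : List α)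
    (F : List α → List α → List α → List α → List α → List α → List α → M) :
    (sum5 vs fun p₁ p₂ p₃ p₄ p₅ => sum2 p₅ fun s t => F p₁ p₂ p₃ p₄ p₅ s t) =
      sum6 vs fun p₁ p₂ p₃ p₄ s t => F p₁ p₂ p₃ p₄ (s ++ t) s t :=
  sum2_congr fun _ _ _ => sum4_refine₄ _ _

theorem sum6_refine₂ (vs : List α)
    (F : List α → List α → List α → List α → List α → List α → List α → List α → M) :
    (sum6 vs fun p₁ p₂ p₃ p₄ p₅ p₆ => sum2 p₂ fun s t => F p₁ p₂ s t p₃ p₄ p₅ p₆) =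
      sum7 vs fun p₁ s t p₃ p₄ p₅ p₆ => F p₁ (s ++ t) s t p₃ p₄ p₅ p₆ :=
  sum2_congr fun _ _ _ => sum5_refine₁ _ _

theorem sum6_refine₃ (vs : List α)
    (F : List α → List α → List α → List α → List α → List α → List α → List α → M) :
    (sum6 vs fun p₁ p₂ p₃ p₄ p₅ p₆ => sum2 p₃ fun s t => F p₁ p₂ p₃ s t p₄ p₅ p₆) =
      sum7 vs fun p₁ p₂ s t p₄ p₅ p₆ => F p₁ p₂ (s ++ t) s t p₄ p₅ p₆ :=
  sum2_congr fun _ _ _ => sum5_refine₂ _ _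

theorem sum6_refine₄ (vs : List α)
    (F : List α → List α → List α → List α → List α → List α → List α → List α → M) :
    (sum6 vs fun p₁ p₂ p₃ p₄ p₅ p₆ => sum2 p₄ fun s t => F p₁ p₂ p₃ p₄ s t p₅ p₆) =
      sum7 vs fun p₁ p₂ p₃ s t p₅ p₆ => F p₁ p₂ p₃ (s ++ t) s t p₅ p₆ :=
  sum2_congr fun _ _ _ => sum5_refine₃ _ _

theorem sum6_refine₅ (vs : List α)
    (F : List α → List α → List α → List α → List α → List α → List α → List α → M) :
    (sum6 vs fun p₁ p₂ p₃ p₄ p₅ p₆ => sum2 p₅ fun s t => F p₁ p₂ p₃ p₄ p₅ s t p₆) =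
      sum7 vs fun p₁ p₂ p₃ p₄ s t p₆ => F p₁ p₂ p₃ p₄ (s ++ t) s t p₆ :=
  sum2_congr fun _ _ _ => sum5_refine₄ _ _

theorem sum6_refine₆ (vs : List α)
    (F : List α → List α → List α → List α → List α → List α → List α → List α → M) :
    (sum6 vs fun p₁ p₂ p₃ p₄ p₅ p₆ => sum2 p₆ fun s t => F p₁ p₂ p₃ p₄ p₅ p₆ s t) =
      sum7 vs fun p₁ p₂ p₃ p₄ p₅ s t => F p₁ p₂ p₃ p₄ p₅ (s ++ t) s t :=
  sum2_congr fun _ _ _ => sum5_refine₅ _ _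

theorem sum2_sub (vs : List α) (F G : List α → List α → M) :
    (sum2 vs fun p q => F p q - G p q) = sum2 vs F - sum2 vs G := by
  rw [eq_sub_iff_add_eq, ← sum2_add]
  simp only [sub_add_cancel]

section Linearity

variable {k : Type*} [Field k] [Module k M]

theorem smul_sum2 (r : k) (vs : List α) (F : List α → List α → M) :
    r • sum2 vs F = sum2 vs fun p q => r • F p q :=
  map_sum2 (DistribSMul.toAddMonoidHom M r) vs F

end Linearity

theorem sum3_add (vs : List α) (F G : List α → List α → List α → M) :
    (sum3 vs fun p₁ p₂ p₃ => F p₁ p₂ p₃ + G p₁ p₂ p₃) = sum3 vs F + sum3 vs G := by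
  simp only [sum3, sum2_add]

theorem sum5_add (vs : List α) (F G : List α → List α → List α → List α → List α → M) :
    (sum5 vs fun p₁ p₂ p₃ p₄ p₅ => F p₁ p₂ p₃ p₄ p₅ + G p₁ p₂ p₃ p₄ p₅) =
      sum5 vs F + sum5 vs G := by
  simp only [sum5, sum2_add]

end SplittingSums

section Insertions

variable {M : Type*} [AddCommGroup M] [Module k M]

/-- The insertion `f{B}` of a single operation `B` of degree `b` into a function of words. -/
def insert1 (f : List (HV V) → M) (b : ℤ) (B : List (HV V) → HV V) (vs : List (HV V)) : M :=
  sum3 vs fun p₁ p₂ p₃ => (-1 : k) ^ (b * degSum V p₁) • f (p₁ ++ B p₂ :: p₃)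

/-- The insertion `f{B, C}`. -/
def insert2 (f : List (HV V) → M) (b : ℤ) (B : List (HV V) → HV V)
    (c : ℤ) (C : List (HV V) → HV V) (vs : List (HV V)) : M :=
  sum5 vs fun p₁ p₂ p₃ p₄ p₅ =>
    (-1 : k) ^ (b * degSum V p₁ + c * (degSum V p₁ + degSum V p₂ + degSum V p₃)) •
      f (p₁ ++ B p₂ :: (p₃ ++ C p₄ :: p₅))

/-- The insertion `f{A, B, C}`. -/
def insert3 (f : List (HV V) → M) (a : ℤ) (A : List (HV V) → HV V)
    (b : ℤ) (B : List (HV V) → HV V) (c : ℤ) (C : List (HV V) → HV V)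
    (vs : List (HV V)) : M :=
  sum7 vs fun p₁ p₂ p₃ p₄ p₅ p₆ p₇ =>
    (-1 : k) ^ (a * degSum V p₁ + b * (degSum V p₁ + degSum V p₂ + degSum V p₃) +
        c * (degSum V p₁ + degSum V p₂ + degSum V p₃ + degSum V p₄ + degSum V p₅)) •
      f (p₁ ++ A p₂ :: (p₃ ++ B p₄ :: (p₅ ++ C p₆ :: p₇)))

/-- The nested insertion `f{A{B, C}}`. -/
def nest (f : List (HV V) → M) (a : ℤ) (A : List (HV V) → HV V)
    (b : ℤ) (B : List (HV V) → HV V) (c : ℤ) (C : List (HV V) → HV V)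
    (vs : List (HV V)) : M :=
  sum7 vs fun p₁ p₂ p₃ p₄ p₅ p₆ p₇ =>
    (-1 : k) ^ ((a + b + c) * degSum V p₁ + b * degSum V p₂ +
        c * (degSum V p₂ + degSum V p₃ + degSum V p₄)) •
      f (p₁ ++ A (p₂ ++ B p₃ :: (p₄ ++ C p₅ :: p₆)) :: p₇)

/-- The nested insertion `f{A{B}, C}`. -/
def nestLeft (f : List (HV V) → M) (a : ℤ) (A : List (HV V) → HV V)
    (b : ℤ) (B : List (HV V) → HV V) (c : ℤ) (C : List (HV V) → HV V)
    (vs : List (HV V)) : M :=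
  sum7 vs fun p₁ p₂ p₃ p₄ p₅ p₆ p₇ =>
    (-1 : k) ^ ((a + b) * degSum V p₁ + b * degSum V p₂ +
        c * (degSum V p₁ + degSum V p₂ + degSum V p₃ + degSum V p₄ + degSum V p₅)) •
      f (p₁ ++ A (p₂ ++ B p₃ :: p₄) :: (p₅ ++ C p₆ :: p₇))

/-- The nested insertion `f{A, B{C}}`. -/
def nestRight (f : List (HV V) → M) (a : ℤ) (A : List (HV V) → HV V)
    (b : ℤ) (B : List (HV V) → HV V) (c : ℤ) (C : List (HV V) → HV V)
    (vs : List (HV V)) : M :=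
  sum7 vs fun p₁ p₂ p₃ p₄ p₅ p₆ p₇ =>
    (-1 : k) ^ (a * degSum V p₁ + (b + c) * (degSum V p₁ + degSum V p₂ + degSum V p₃) +
        c * degSum V p₄) •
      f (p₁ ++ A p₂ :: (p₃ ++ B (p₄ ++ C p₅ :: p₆) :: p₇))

theorem degSum_append (xs ys : List (HV V)) :
    degSum V (xs ++ ys) = degSum V xs + degSum V ys := by
  simp [degSum]

theorem degSum_cons (x : HV V) (xs : List (HV V)) :
    degSum V (x :: xs) = x.1 + degSum V xs := by
  simp [degSum]

theorem smul_sum7 (r : k) (vs : List (HV V)) (F : List (HV V) → List (HV V) → List (HV V) →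
    List (HV V) → List (HV V) → List (HV V) → List (HV V) → M) :
    r • sum7 vs F = sum7 vs fun p₁ p₂ p₃ p₄ p₅ p₆ p₇ => r • F p₁ p₂ p₃ p₄ p₅ p₆ p₇ := by
  simp only [sum7, smul_sum2]

theorem sum7_zpow_smul_congr {vs : List (HV V)}
    {m n : List (HV V) → List (HV V) → List (HV V) → List (HV V) → List (HV V) →
      List (HV V) → List (HV V) → ℤ}
    {F : List (HV V) → List (HV V) → List (HV V) → List (HV V) → List (HV V) →
      List (HV V) → List (HV V) → M}
    (h : ∀ p₁ p₂ p₃ p₄ p₅ p₆ p₇, m p₁ p₂ p₃ p₄ p₅ p₆ p₇ = n p₁ p₂ p₃ p₄ p₅ p₆ p₇) :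
    (sum7 vs fun p₁ p₂ p₃ p₄ p₅ p₆ p₇ =>
        (-1 : k) ^ m p₁ p₂ p₃ p₄ p₅ p₆ p₇ • F p₁ p₂ p₃ p₄ p₅ p₆ p₇) =
      sum7 vs fun p₁ p₂ p₃ p₄ p₅ p₆ p₇ =>
        (-1 : k) ^ n p₁ p₂ p₃ p₄ p₅ p₆ p₇ • F p₁ p₂ p₃ p₄ p₅ p₆ p₇ := by
  simp only [h]

theorem negOne_zpow_add (m n : ℤ) : (-1 : k) ^ (m + n) = (-1) ^ m * (-1) ^ n :=
  zpow_add₀ (by simp) m n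

/-- The brace relation for `(f{A}){B, C}`. -/
theorem insert2_insert1 (f : List (HV V) → M) {a b c : ℤ} {A B C : List (HV V) → HV V}
    (hB : ∀ vs, (B vs).1 = b + degSum V vs) (hC : ∀ vs, (C vs).1 = c + degSum V vs)
    (vs : List (HV V)) :
    insert2 k V (insert1 k V f a A) b B c C vs =
      insert3 k V f a A b B c C vs + nestLeft k V f a A b B c C vs +
      nest k V f a A b B c C vs + (-1 : k) ^ (a * b) • insert3 k V f b B a A c C vs +
      (-1 : k) ^ (a * b) • nestRight k V f b B a A c C vs +
      (-1 : k) ^ (a * (b + c)) • insert3 k V f b B c C a A vs := by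
  simp only [nest, nestLeft, nestRight, insert3, smul_sum7]
  simp only [insert2, insert1, sum3, sum2_append_cons, sum2_add, smul_add, smul_sum2,
    sum5_add, sum5_refine₁, sum5_refine₃, sum5_refine₅, sum6_refine₂, sum6_refine₄,
    sum6_refine₆, smul_smul, ← negOne_zpow_add, List.append_assoc, List.cons_append,
    degSum_append, degSum_cons, hB, hC]
  simp only [← add_assoc (_ : M)]
  refine congrArg₂ _ (congrArg₂ _ (congrArg₂ _ (congrArg₂ _ (congrArg₂ _ ?_ ?_) ?_) ?_) ?_) ?_ <;>
    exact sum7_zpow_smul_congr k V fun _ _ _ _ _ _ _ => by ring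

/-- The brace relation for `(f{B, C}){A}`. -/
theorem insert1_insert2 (f : List (HV V) → M) {a b c : ℤ} {A B C : List (HV V) → HV V}
    (hA : ∀ vs, (A vs).1 = a + degSum V vs)
    (vs : List (HV V)) :
    insert1 k V (insert2 k V f b B c C) a A vs =
      insert3 k V f b B c C a A vs + nestRight k V f b B c C a A vs +
      (-1 : k) ^ (a * c) • insert3 k V f b B a A c C vs +
      (-1 : k) ^ (a * c) • nestLeft k V f b B a A c C vs +
      (-1 : k) ^ (a * (b + c)) • insert3 k V f a A b B c C vs := by
  simp only [nestLeft, nestRight, insert3, smul_sum7]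
  simp only [insert2, insert1, sum5, sum2_append_cons, sum2_add, smul_add, smul_sum2, sum3_add,
    List.append_assoc, List.cons_append]
  simp only [sum3_refine₁, sum3_refine₃, sum4_refine₂, sum4_refine₄,
    sum5_refine₃, sum5_refine₅, sum6_refine₄,
    sum6_refine₆, smul_smul, ← negOne_zpow_add,
    degSum_append, degSum_cons, hA]
  refine congrArg₂ _ (congrArg₂ _ (congrArg₂ _ (congrArg₂ _ ?_ ?_) ?_) ?_) ?_ <;>
    exact sum7_zpow_smul_congr k V fun _ _ _ _ _ _ _ => by ring

end Insertions

section LinearInsertions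

variable {M N : Type*} [AddCommGroup M] [Module k M] [AddCommGroup N] [Module k N]

/-- The insertion of a module-valued operation `β` of degree `d` into a function of words which
has been extended linearly in one letter. -/
def linInsert1 (F : List (HV V) → List (HV V) → N →ₗ[k] M) (d : ℤ) (β : List (HV V) → N)
    (vs : List (HV V)) : M :=
  sum3 vs fun p₁ p₂ p₃ => (-1 : k) ^ (d * degSum V p₁) • F p₁ p₃ (β p₂)

/-- The insertion of a module-valued operation `β` followed by an operation `C`. -/
def linInsertLeft (F : List (HV V) → List (HV V) → N →ₗ[k] M) (d : ℤ) (β : List (HV V) → N)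
    (c : ℤ) (C : List (HV V) → HV V) (vs : List (HV V)) : M :=
  sum5 vs fun p₁ p₂ p₃ p₄ p₅ =>
    (-1 : k) ^ (d * degSum V p₁ + c * (degSum V p₁ + degSum V p₂ + degSum V p₃)) •
      F p₁ (p₃ ++ C p₄ :: p₅) (β p₂)

/-- The insertion of an operation `B` followed by a module-valued operation `γ`. -/
def linInsertRight (F : List (HV V) → List (HV V) → N →ₗ[k] M) (b : ℤ)
    (B : List (HV V) → HV V) (d : ℤ) (γ : List (HV V) → N) (vs : List (HV V)) : M :=
  sum5 vs fun p₁ p₂ p₃ p₄ p₅ =>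
    (-1 : k) ^ (b * degSum V p₁ + d * (degSum V p₁ + degSum V p₂ + degSum V p₃)) •
      F (p₁ ++ B p₂ :: p₃) p₅ (γ p₄)

theorem linInsertLeft_sub_smul (F : List (HV V) → List (HV V) → N →ₗ[k] M) (d : ℤ)
    (β β' : List (HV V) → N) (r : k) (c : ℤ) (C : List (HV V) → HV V) (vs : List (HV V)) :
    linInsertLeft k V F d (β - r • β') c C vs =
      linInsertLeft k V F d β c C vs - r • linInsertLeft k V F d β' c C vs := by
  simp only [linInsertLeft, sum5, Pi.sub_apply, Pi.smul_apply, map_sub, map_smul, smul_sum2,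
    smul_sub, sum2_sub, smul_comm r]

theorem linInsertRight_sub_smul (F : List (HV V) → List (HV V) → N →ₗ[k] M) (b : ℤ)
    (B : List (HV V) → HV V) (d : ℤ) (γ γ' : List (HV V) → N) (r : k) (vs : List (HV V)) :
    linInsertRight k V F b B d (γ - r • γ') vs =
      linInsertRight k V F b B d γ vs - r • linInsertRight k V F b B d γ' vs := by
  simp only [linInsertRight, sum5, Pi.sub_apply, Pi.smul_apply, map_sub, map_smul, smul_sum2,
    smul_sub, sum2_sub, smul_comm r]

theorem insert2_sub_smul (f g : List (HV V) → M) (r : k) (b : ℤ) (B : List (HV V) → HV V)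
    (c : ℤ) (C : List (HV V) → HV V) (vs : List (HV V)) :
    insert2 k V (f - r • g) b B c C vs =
      insert2 k V f b B c C vs - r • insert2 k V g b B c C vs := by
  simp only [insert2, sum5, Pi.sub_apply, Pi.smul_apply, smul_sum2, smul_sub, sum2_sub,
    smul_comm r]

variable {e : HV V → N} {F : List (HV V) → List (HV V) → N →ₗ[k] M} {f : List (HV V) → M}

theorem linInsert1_insert2 (hF : ∀ xs zs x, F xs zs (e x) = f (xs ++ x :: zs))
    (a : ℤ) (A : List (HV V) → HV V) (b : ℤ) (B : List (HV V) → HV V)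
    (c : ℤ) (C : List (HV V) → HV V) (vs : List (HV V)) :
    linInsert1 k V F (a + b + c) (insert2 k V (fun us => e (A us)) b B c C) vs =
      nest k V f a A b B c C vs := by
  simp only [linInsert1, insert2, sum5, map_sum2, map_smul, smul_sum2, hF]
  simp only [sum3_refine₂, sum4_refine₃, sum5_refine₄, sum6_refine₅, smul_smul,
    ← negOne_zpow_add]
  exact sum7_zpow_smul_congr k V fun _ _ _ _ _ _ _ => by ring

theorem linInsertLeft_insert1 (hF : ∀ xs zs x, F xs zs (e x) = f (xs ++ x :: zs))
    {a b : ℤ} {A B : List (HV V) → HV V}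
    (c : ℤ) (C : List (HV V) → HV V) (vs : List (HV V)) :
    linInsertLeft k V F (a + b) (insert1 k V (fun us => e (A us)) b B) c C vs =
      nestLeft k V f a A b B c C vs := by
  simp only [linInsertLeft, insert1, sum3, map_sum2, map_smul, smul_sum2, hF]
  simp only [sum5_refine₂, sum6_refine₃, smul_smul, ← negOne_zpow_add, degSum_append]
  exact sum7_zpow_smul_congr k V fun _ _ _ _ _ _ _ => by ring

theorem linInsertRight_insert1 (hF : ∀ xs zs x, F xs zs (e x) = f (xs ++ x :: zs))
    (a : ℤ) (A : List (HV V) → HV V) {b c : ℤ} {B C : List (HV V) → HV V}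
    (vs : List (HV V)) :
    linInsertRight k V F a A (b + c) (insert1 k V (fun us => e (B us)) c C) vs =
      nestRight k V f a A b B c C vs := by
  simp only [linInsertRight, insert1, sum3, map_sum2, map_smul, smul_sum2, hF]
  simp only [sum5_refine₄, sum6_refine₅, smul_smul, ← negOne_zpow_add,
    List.append_assoc, List.cons_append]
  exact sum7_zpow_smul_congr k V fun _ _ _ _ _ _ _ => by ring

theorem linInsert1_eq (hF : ∀ xs zs x, F xs zs (e x) = f (xs ++ x :: zs))
    (d : ℤ) (Y : List (HV V) → HV V) (vs : List (HV V)) :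
    insert1 k V f d Y vs = linInsert1 k V F d (fun us => e (Y us)) vs := by
  simp only [linInsert1, insert1, hF]

theorem linInsertLeft_eq (hF : ∀ xs zs x, F xs zs (e x) = f (xs ++ x :: zs))
    (d : ℤ) (Y : List (HV V) → HV V) (c : ℤ) (C : List (HV V) → HV V) (vs : List (HV V)) :
    insert2 k V f d Y c C vs = linInsertLeft k V F d (fun us => e (Y us)) c C vs := by
  simp only [linInsertLeft, insert2, hF]

theorem linInsertRight_eq (hF : ∀ xs zs x, F xs zs (e x) = f (xs ++ x :: zs))
    (b : ℤ) (B : List (HV V) → HV V) (d : ℤ) (Y : List (HV V) → HV V) (vs : List (HV V)) :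
    insert2 k V f b B d Y vs = linInsertRight k V F b B d (fun us => e (Y us)) vs := by
  simp only [linInsertRight, insert2, hF, List.append_assoc, List.cons_append]

end LinearInsertions

section Values

/-- A homogeneous element as an element of the direct sum. -/
def toSum (x : HV V) : DirectSum ℤ V := DirectSum.lof k ℤ V x.1 x.2

/-- A graded map as an operation taking homogeneous tuples to homogeneous elements. -/
def op {a : ℤ} (A : E V a) (vs : List (HV V)) : HV V := ⟨a + degSum V vs, A vs⟩

/-- A graded map with values in the direct sum. -/
def value {a : ℤ} (A : E V a) (vs : List (HV V)) : DirectSum ℤ V := toSum k V (op V A vs)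

theorem value_injective {a : ℤ} : Function.Injective (value k V : E V a → _) := fun _ _ h =>
  funext fun vs => DirectSum.of_injective _ (congrFun h vs)

theorem toSum_vcast {a b : ℤ} (h : a = b) (x : V a) :
    toSum k V ⟨b, vcast V x⟩ = toSum k V ⟨a, x⟩ := by
  subst h
  simp [vcast]

theorem toSum_add {l : ℤ} (x y : V l) :
    toSum k V ⟨l, x + y⟩ = toSum k V ⟨l, x⟩ + toSum k V ⟨l, y⟩ :=
  map_add (DirectSum.lof k ℤ V l) x y

theorem toSum_smul {l : ℤ} (r : k) (x : V l) :
    toSum k V ⟨l, r • x⟩ = r • toSum k V ⟨l, x⟩ :=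
  map_smul (DirectSum.lof k ℤ V l) r x

theorem value_recast {a b : ℤ} (h : a = b) (A : E V a) :
    value k V (recast V A : E V b) = value k V A :=
  funext fun _ => toSum_vcast k V (by rw [h]) _

theorem value_sub {a : ℤ} (A B : E V a) : value k V (A - B) = value k V A - value k V B :=
  funext fun _ => map_sub (DirectSum.lof k ℤ V _) _ _

theorem value_smul {a : ℤ} (r : k) (A : E V a) : value k V (r • A) = r • value k V A :=
  funext fun _ => map_smul (DirectSum.lof k ℤ V _) _ _

theorem value_zero {a : ℤ} : value k V (0 : E V a) = 0 :=
  funext fun _ => map_zero (DirectSum.lof k ℤ V _)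

theorem sum_map_splits3 {α M : Type*} [AddCommGroup M] (vs : List α)
    (g : List α × List α × List α → M) :
    ((splits3 vs).map g).sum = sum3 vs fun p₁ p₂ p₃ => g (p₁, p₂, p₃) := by
  simp only [splits3, sum3, sum2, List.flatMap_def, List.map_flatten, List.map_map,
    List.sum_flatten, Function.comp_def]

theorem sum_map_ins_pair {M : Type*} [AddCommGroup M] {b c : ℤ} (B : E V b) (C : E V c)
    (vs : List (HV V)) (g : ℤ × List (HV V) → M) :
    ((ins V [⟨b, B⟩, ⟨c, C⟩] vs).map g).sum = sum5 vs fun p₁ p₂ p₃ p₄ p₅ =>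
      g (b * degSum V p₁ + c * (degSum V p₁ + degSum V p₂ + degSum V p₃),
        p₁ ++ op V B p₂ :: (p₃ ++ op V C p₄ :: p₅)) := by
  simp only [ins, splits3, sum5, sum2, List.flatMap_def, List.map_flatten, List.map_map,
    List.sum_flatten, Function.comp_def, List.map_cons, List.map_nil, List.sum_cons,
    List.sum_nil, degl, op, add_zero, zero_mul, mul_add, add_assoc]

theorem sum3_congr {α M : Type*} [AddCommGroup M] {vs : List α}
    {F G : List α → List α → List α → M}
    (h : ∀ p₁ p₂ p₃, p₁ ++ (p₂ ++ p₃) = vs → F p₁ p₂ p₃ = G p₁ p₂ p₃) :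
    sum3 vs F = sum3 vs G :=
  sum2_congr fun _ _ e => sum2_congr fun _ _ e' => h _ _ _ (by rw [e', e])

theorem sum5_congr {α M : Type*} [AddCommGroup M] {vs : List α}
    {F G : List α → List α → List α → List α → List α → M}
    (h : ∀ p₁ p₂ p₃ p₄ p₅, p₁ ++ (p₂ ++ (p₃ ++ (p₄ ++ p₅))) = vs →
      F p₁ p₂ p₃ p₄ p₅ = G p₁ p₂ p₃ p₄ p₅) :
    sum5 vs F = sum5 vs G :=
  sum2_congr fun _ _ e => sum2_congr fun _ _ e' =>
    sum3_congr fun _ _ _ e'' => h _ _ _ _ _ (by rw [e'', e', e])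

theorem value_gcomp {a b : ℤ} (A : E V a) (B : E V b) :
    value k V (gcomp k V A B) = insert1 k V (value k V A) b (op V B) := by
  funext vs
  simp only [value, op, gcomp, sum_map_splits3, insert1]
  simp only [toSum, sum3, map_sum2, map_smul]
  refine sum3_congr fun p₁ p₂ p₃ e => congrArg _ (toSum_vcast k V ?_ _)
  simp only [← e, degSum_append, degSum_cons]
  ring

theorem value_braces {a b c : ℤ} (A : E V a) (B : E V b) (C : E V c) :
    value k V (braces k V A [⟨b, B⟩, ⟨c, C⟩]) =
      insert2 k V (value k V A) b (op V B) c (op V C) := by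
  funext vs
  simp only [value, op, braces, sum_map_ins_pair, insert2]
  simp only [toSum, sum5, map_sum2, map_smul]
  refine sum5_congr fun p₁ p₂ p₃ p₄ p₅ e => congrArg _ (toSum_vcast k V ?_ _)
  simp only [← e, degSum_append, degSum_cons, degl, List.map_cons, List.map_nil,
    List.sum_cons, List.sum_nil]
  ring

/-- Linearity of a function of one homogeneous letter. -/
def IsLetterLinear {M : Type*} [AddCommGroup M] [Module k M] (g : HV V → M) : Prop :=
  (∀ l (x y : V l), g ⟨l, x + y⟩ = g ⟨l, x⟩ + g ⟨l, y⟩) ∧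
    ∀ l (r : k) (x : V l), g ⟨l, r • x⟩ = r • g ⟨l, x⟩

theorem isMultilinear_iff {d : ℤ} {f : E V d} : IsMultilinear k V f ↔
    ∀ xs zs, IsLetterLinear k V fun x => value k V f (xs ++ x :: zs) := by
  have key (xs zs : List (HV V)) (l : ℤ) (x : V l) : value k V f (xs ++ ⟨l, x⟩ :: zs) =
      toSum k V ⟨d + degSum V xs + l + degSum V zs, vcast V (f (xs ++ ⟨l, x⟩ :: zs))⟩ :=
    (toSum_vcast k V (by simp only [degSum_append, degSum_cons]; ring) _).symm
  simp only [IsLetterLinear, key, ← toSum_add, ← toSum_smul]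
  constructor
  · intro h xs zs
    exact ⟨fun l x y => by rw [h.1], fun l r x => by rw [h.2]⟩
  · intro h
    exact ⟨fun xs zs l x y => DirectSum.of_injective _ ((h xs zs).1 l x y),
      fun xs zs l r x => DirectSum.of_injective _ ((h xs zs).2 l r x)⟩

theorem IsMultilinear.exists_linear {d : ℤ} {f : E V d} (hf : IsMultilinear k V f) :
    ∃ F : List (HV V) → List (HV V) → DirectSum ℤ V →ₗ[k] DirectSum ℤ V,
      ∀ xs zs x, F xs zs (toSum k V x) = value k V f (xs ++ x :: zs) := by
  rw [isMultilinear_iff] at hf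
  exact ⟨fun xs zs => DirectSum.toModule k ℤ _ fun l =>
    { toFun := fun x => value k V f (xs ++ ⟨l, x⟩ :: zs)
      map_add' := (hf xs zs).1 l
      map_smul' := (hf xs zs).2 l }, fun xs zs x => DirectSum.toModule_lof k _ _⟩

section LetterLinear

variable {k V}
variable {M N : Type*} [AddCommGroup M] [Module k M] [AddCommGroup N] [Module k N]

theorem IsLetterLinear.add {g h : HV V → M} (hg : IsLetterLinear k V g)
    (hh : IsLetterLinear k V h) : IsLetterLinear k V fun x => g x + h x :=
  ⟨fun l x y => by beta_reduce; rw [hg.1, hh.1, add_add_add_comm],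
    fun l r x => by beta_reduce; rw [hg.2, hh.2, smul_add]⟩

theorem IsLetterLinear.smul {g : HV V → M} {r : HV V → k} (hg : IsLetterLinear k V g)
    (hr : ∀ l (x y : V l), r ⟨l, x⟩ = r ⟨l, y⟩) : IsLetterLinear k V fun x => r x • g x :=
  ⟨fun l x y => by beta_reduce; rw [hg.1, smul_add, hr l (x + y) x, hr l y x],
    fun l s x => by beta_reduce; rw [hg.2, smul_comm, hr l (s • x) x]⟩

theorem IsLetterLinear.map {g : HV V → N} (hg : IsLetterLinear k V g) (L : N →ₗ[k] M) :
    IsLetterLinear k V fun x => L (g x) :=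
  ⟨fun l x y => by beta_reduce; rw [hg.1, map_add],
    fun l r x => by beta_reduce; rw [hg.2, map_smul]⟩

theorem IsLetterLinear.sum2 {vs : List (HV V)} {g : List (HV V) → List (HV V) → HV V → M}
    (hg : ∀ p q, IsLetterLinear k V (g p q)) :
    IsLetterLinear k V fun x => sum2 vs fun p q => g p q x :=
  ⟨fun l x y => by simp only [(hg _ _).1, sum2_add],
    fun l r x => by simp only [(hg _ _).2, smul_sum2]⟩

end LetterLinear

theorem IsMultilinear.smul {a : ℤ} {A : E V a} (hA : IsMultilinear k V A) (r : k) :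
    IsMultilinear k V (r • A) := by
  rw [isMultilinear_iff] at hA ⊢
  intro xs zs
  rw [value_smul]
  exact (hA xs zs).smul fun _ _ _ => rfl

theorem IsMultilinear.recast {a b : ℤ} (h : a = b) {A : E V a} (hA : IsMultilinear k V A) :
    IsMultilinear k V (recast V A : E V b) := by
  rw [isMultilinear_iff] at hA ⊢
  rwa [value_recast k V h]

theorem IsMultilinear.braces_pair {a b c : ℤ} {A : E V a} {B : E V b} {C : E V c}
    (hA : IsMultilinear k V A) (hB : IsMultilinear k V B) (hC : IsMultilinear k V C) :
    IsMultilinear k V (braces k V A [⟨b, B⟩, ⟨c, C⟩]) := by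
  obtain ⟨F, hF⟩ := hA.exists_linear
  rw [isMultilinear_iff] at hA hB hC ⊢
  intro xs zs
  have hAB (p q s t) : IsLetterLinear k V fun x =>
      value k V A (p ++ op V B (s ++ x :: t) :: q) := by
    simp only [← hF]
    exact (hB s t).map (F p q)
  have hAC (p q s t) : IsLetterLinear k V fun x =>
      value k V A (p ++ op V C (s ++ x :: t) :: q) := by
    simp only [← hF]
    exact (hC s t).map (F p q)
  simp only [value_braces, insert2, sum5, sum2_append_cons]
  refine .add (.sum2 fun p₁ r₁ => .add (.sum2 fun p₂ r₂ => .add (.sum2 fun p₃ r₃ =>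
    .add (.sum2 fun p₄ r₄ => ?_) (.sum2 fun p₄ r₄ => ?_))
    (.sum2 fun p₃ r₃ => .sum2 fun p₄ r₄ => ?_))
    (.sum2 fun p₂ r₂ => .sum2 fun p₃ r₃ => .sum2 fun p₄ r₄ => ?_))
    (.sum2 fun p₁ r₁ => .sum2 fun p₂ r₂ => .sum2 fun p₃ r₃ => .sum2 fun p₄ r₄ => ?_) <;>
  refine .smul ?_ fun _ _ _ => by simp only [degSum_append, degSum_cons]
  · simpa only [List.append_assoc, List.cons_append] using
      hA (p₁ ++ op V B p₂ :: (p₃ ++ op V C p₄ :: r₄)) zs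
  · simpa only [List.append_assoc, List.cons_append] using hAC (p₁ ++ op V B p₂ :: p₃) r₄ r₃ p₄
  · simpa only [List.append_assoc, List.cons_append] using
      hA (p₁ ++ op V B p₂ :: r₂) (p₃ ++ op V C p₄ :: r₄)
  · exact hAB _ _ _ _
  · simpa only [List.append_assoc, List.cons_append] using hA xs _

variable {k V} in
theorem insert1_of_value_eq_insert2 {d a b c e : ℤ} {f : E V d} {A : E V a} {B : E V b}
    {C : E V c} {Y : E V e} (hf : IsMultilinear k V f) (he : e = a + b + c)
    (hY : value k V Y = insert2 k V (value k V A) b (op V B) c (op V C)) (vs : List (HV V)) :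
    insert1 k V (value k V f) e (op V Y) vs =
      nest k V (value k V f) a (op V A) b (op V B) c (op V C) vs := by
  obtain ⟨F, hF⟩ := hf.exists_linear
  rw [linInsert1_eq k V hF]
  change linInsert1 k V F e (value k V Y) vs = _
  rw [hY, he]
  exact linInsert1_insert2 k V hF a (op V A) b (op V B) c (op V C) vs

variable {k V} in
theorem insert2_left_of_value_eq {d a b a' b' c e : ℤ} {f : E V d} {A : E V a} {B : E V b}
    {A' : E V a'} {B' : E V b'} {Y : E V e} {r : k} (hf : IsMultilinear k V f)
    (he : e = a + b) (he' : e = a' + b')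
    (hY : value k V Y = insert1 k V (value k V A) b (op V B) -
      r • insert1 k V (value k V A') b' (op V B')) (C : E V c) (vs : List (HV V)) :
    insert2 k V (value k V f) e (op V Y) c (op V C) vs =
      nestLeft k V (value k V f) a (op V A) b (op V B) c (op V C) vs -
        r • nestLeft k V (value k V f) a' (op V A') b' (op V B') c (op V C) vs := by
  obtain ⟨F, hF⟩ := hf.exists_linear
  rw [linInsertLeft_eq k V hF]
  change linInsertLeft k V F e (value k V Y) c (op V C) vs = _
  rw [hY, linInsertLeft_sub_smul, ← linInsertLeft_insert1 k V hF, ← he,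
    ← linInsertLeft_insert1 k V hF, ← he']
  rfl

variable {k V} in
theorem insert2_right_of_value_eq {d a b c b' c' e : ℤ} {f : E V d} {B : E V b} {C : E V c}
    {B' : E V b'} {C' : E V c'} {Y : E V e} {r : k} (hf : IsMultilinear k V f)
    (he : e = b + c) (he' : e = b' + c')
    (hY : value k V Y = insert1 k V (value k V B) c (op V C) -
      r • insert1 k V (value k V B') c' (op V C')) (A : E V a) (vs : List (HV V)) :
    insert2 k V (value k V f) a (op V A) e (op V Y) vs =
      nestRight k V (value k V f) a (op V A) b (op V B) c (op V C) vs -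
        r • nestRight k V (value k V f) a (op V A) b' (op V B') c' (op V C') vs := by
  obtain ⟨F, hF⟩ := hf.exists_linear
  rw [linInsertRight_eq k V hF]
  change linInsertRight k V F a (op V A) e (value k V Y) vs = _
  rw [hY, linInsertRight_sub_smul, ← linInsertRight_insert1 k V hF, ← he,
    ← linInsertRight_insert1 k V hF, ← he']
  rfl

theorem value_gbr {a b : ℤ} (A : E V a) (B : E V b) :
    value k V (gbr k V A B) = insert1 k V (value k V A) b (op V B) -
      (-1 : k) ^ (a * b) • insert1 k V (value k V B) a (op V A) := by
  rw [gbr, value_sub, value_smul, value_recast k V (add_comm b a), value_gcomp, value_gcomp]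

theorem value_M1 (m : E V 1) {a : ℤ} (A : E V a) :
    value k V (M1 k V m A) = insert1 k V (value k V m) a (op V A) -
      (-1 : k) ^ a • insert1 k V (value k V A) 1 (op V m) := by
  rw [M1, value_sub, value_smul, value_recast k V (add_comm 1 a), value_recast k V rfl,
    value_gcomp, value_gcomp]

theorem value_recast_braces {a b c e : ℤ} (h : a + b + c = e) (A : E V a) (B : E V b)
    (C : E V c) : value k V (recast V (braces k V A [⟨b, B⟩, ⟨c, C⟩]) : E V e) =
      insert2 k V (value k V A) b (op V B) c (op V C) := by
  rw [value_recast k V (by simp [degl, ← h, add_assoc]), value_braces]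

theorem value_M2 (m : E V 1) {a b : ℤ} (A : E V a) (B : E V b) :
    value k V (M2 k V m A B) = insert2 k V (value k V m) a (op V A) b (op V B) :=
  value_recast_braces k V (by ring) m A B

end Values

theorem negOne_zpow_eq_or (n : ℤ) : (-1 : k) ^ n = 1 ∨ (-1 : k) ^ n = -1 := by
  rcases n.even_or_odd with h | h
  · exact .inl h.neg_one_zpow
  · exact .inr h.neg_one_zpow

variable {k V} in
theorem gbr_M2_cochain_identity {m : E V 1} (hm : IsMultilinear k V m) {a b c : ℤ}
    {A : E V a} (B : E V b) (C : E V c) (hA : IsMultilinear k V A) :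
    (recast V (gbr k V A (M2 k V m B C)) : E V (a + b + c + 1)) -
        ((-1 : k) ^ a) • recast V (M2 k V m (gbr k V A B) C) -
        ((-1 : k) ^ (a * (b + 1))) • recast V (M2 k V m B (gbr k V A C)) =
      ((-1 : k) ^ a) •
        (recast V (M1 k V m (recast V (braces k V A [⟨b, B⟩, ⟨c, C⟩]) : E V (a + b + c))) -
          recast V (braces k V (M1 k V m A) [⟨b, B⟩, ⟨c, C⟩]) -
          ((-1 : k) ^ a) • recast V (braces k V A [⟨b + 1, M1 k V m B⟩, ⟨c, C⟩]) -
          ((-1 : k) ^ (a + b)) • recast V (braces k V A [⟨b, B⟩, ⟨c + 1, M1 k V m C⟩])) := by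
  refine value_injective k V (funext fun vs => ?_)
  have hop {d : ℤ} (Y : E V d) (us : List (HV V)) : (op V Y us).1 = d + degSum V us := rfl
  have hAB : value k V (recast V (braces k V A [⟨b, B⟩, ⟨c, C⟩]) : E V (a + b + c)) =
      insert2 k V (value k V A) b (op V B) c (op V C) := value_recast_braces k V rfl A B C
  simp only [value_sub, value_smul, Pi.sub_apply, Pi.smul_apply]
  rw [value_recast k V (by ring), value_recast k V (by ring), value_recast k V (by ring),
    value_recast k V rfl, value_recast_braces k V (by ring), value_recast_braces k V (by ring),
    value_recast_braces k V (by ring), value_gbr, value_M2, value_M2, value_M2, value_M1,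
    value_M1, hAB, insert2_sub_smul]
  simp only [Pi.sub_apply, Pi.smul_apply]
  rw [insert1_of_value_eq_insert2 hA (by ring) (value_M2 k V m B C),
    insert1_of_value_eq_insert2 hm rfl hAB,
    insert2_left_of_value_eq hm rfl (add_comm a b) (value_gbr k V A B),
    insert2_right_of_value_eq hm rfl (add_comm a c) (value_gbr k V A C),
    insert2_left_of_value_eq hA (add_comm b 1) rfl (value_M1 k V m B),
    insert2_right_of_value_eq hA (add_comm c 1) rfl (value_M1 k V m C),
    insert1_insert2 k V _ (hop A), insert1_insert2 k V _ (hop m),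
    insert2_insert1 k V _ (hop B) (hop C), insert2_insert1 k V _ (hop B) (hop C)]
  simp only [mul_add, mul_one, one_mul, negOne_zpow_add]
  rcases negOne_zpow_eq_or k a with h₁ | h₁ <;> rcases negOne_zpow_eq_or k b with h₂ | h₂ <;>
  rcases negOne_zpow_eq_or k c with h₃ | h₃ <;>
  rcases negOne_zpow_eq_or k (a * b) with h₄ | h₄ <;>
  rcases negOne_zpow_eq_or k (a * c) with h₅ | h₅ <;>
  · simp only [h₁, h₂, h₃, h₄, h₅]
    module

section Scalars

theorem recast_smul {a b : ℤ} (h : a = b) (r : k) (A : E V a) :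
    (recast V (r • A) : E V b) = r • recast V A :=
  value_injective k V <| by rw [value_smul, value_recast k V h, value_recast k V h, value_smul]

theorem recast_zero {a b : ℤ} : (recast V (0 : E V a) : E V b) = 0 := by
  funext vs
  by_cases h : a + degSum V vs = b + degSum V vs
  · obtain rfl : a = b := add_right_cancel h
    simp [recast, vcast]
  · simp [recast, vcast, h]

theorem insert1_smul {M : Type*} [AddCommGroup M] [Module k M] (f : List (HV V) → M) (r : k)
    (b : ℤ) (B : List (HV V) → HV V) : insert1 k V (r • f) b B = r • insert1 k V f b B := by
  funext vs
  simp only [insert1, sum3, Pi.smul_apply, smul_sum2, smul_comm r]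

variable {k V}

theorem IsMultilinear.insert1_op_smul {d a : ℤ} {f : E V d} (hf : IsMultilinear k V f) (r : k)
    (X : E V a) :
    insert1 k V (value k V f) a (op V (r • X)) = r • insert1 k V (value k V f) a (op V X) := by
  obtain ⟨F, hF⟩ := hf.exists_linear
  funext vs
  rw [Pi.smul_apply, linInsert1_eq k V hF, linInsert1_eq k V hF]
  change linInsert1 k V F a (value k V (r • X)) vs = r • linInsert1 k V F a (value k V X) vs
  simp only [value_smul, linInsert1, sum3, Pi.smul_apply, map_smul, smul_sum2, smul_comm r]

theorem IsMultilinear.gbr_smul {a b : ℤ} {A : E V a} (hA : IsMultilinear k V A) (r : k)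
    (X : E V b) : gbr k V A (r • X) = r • gbr k V A X :=
  value_injective k V <| by
    rw [value_smul, value_gbr, value_gbr, hA.insert1_op_smul, value_smul, insert1_smul, smul_sub,
      smul_comm r]

theorem IsMultilinear.M1_smul {m : E V 1} (hm : IsMultilinear k V m) {a : ℤ} (r : k)
    (X : E V a) : M1 k V m (r • X) = r • M1 k V m X :=
  value_injective k V <| by
    rw [value_smul, value_M1, value_M1, hm.insert1_op_smul, value_smul, insert1_smul, smul_sub,
      smul_comm r]

theorem zero_braces_pair {a b c : ℤ} (B : E V b) (C : E V c) :
    braces k V (0 : E V a) [⟨b, B⟩, ⟨c, C⟩] = 0 :=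
  value_injective k V <| funext fun vs => by
    simp [value_braces, value_zero, insert2, sum5, sum2]

theorem IsMultilinear.braces_zero_left {a b c : ℤ} {A : E V a} (hA : IsMultilinear k V A)
    (C : E V c) : braces k V A [⟨b, 0⟩, ⟨c, C⟩] = 0 := by
  obtain ⟨F, hF⟩ := hA.exists_linear
  refine value_injective k V <| funext fun vs => ?_
  rw [value_braces, linInsertLeft_eq k V hF]
  change linInsertLeft k V F b (value k V 0) c (op V C) vs = _
  simp [value_zero, linInsertLeft, sum5, sum2]

theorem IsMultilinear.braces_zero_right {a b c : ℤ} {A : E V a} (hA : IsMultilinear k V A)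
    (B : E V b) : braces k V A [⟨b, B⟩, ⟨c, 0⟩] = 0 := by
  obtain ⟨F, hF⟩ := hA.exists_linear
  refine value_injective k V <| funext fun vs => ?_
  rw [value_braces, linInsertRight_eq k V hF]
  change linInsertRight k V F b (op V B) c (value k V 0) vs = _
  simp [value_zero, linInsertRight, sum5, sum2]

theorem gbr_cup_of_cocycles {m : E V 1} (hm : IsMultilinear k V m) {a b c : ℤ}
    {A : E V a} {B : E V b} {C : E V c} (hA : IsMultilinear k V A)
    (hA₀ : M1 k V m A = 0) (hB₀ : M1 k V m B = 0) (hC₀ : M1 k V m C = 0) :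
    (recast V (gbr k V A (cup k V m B C)) : E V (a + b + c + 1)) -
        recast V (cup k V m (gbr k V A B) C) -
        ((-1 : k) ^ (a * (b + 1))) • recast V (cup k V m B (gbr k V A C)) =
      M1 k V m (((-1 : k) ^ (b - 1) * (-1) ^ a) •
        (recast V (braces k V A [⟨b, B⟩, ⟨c, C⟩]) : E V (a + b + c))) := by
  have h := gbr_M2_cochain_identity hm B C hA
  have hM : (recast V (M1 k V m (recast V (braces k V A [⟨b, B⟩, ⟨c, C⟩]) : E V (a + b + c))) :
      E V (a + b + c + 1)) = M1 k V m (recast V (braces k V A [⟨b, B⟩, ⟨c, C⟩])) :=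
    value_injective k V (value_recast k V rfl _)
  rw [hA₀, hB₀, hC₀, zero_braces_pair, hA.braces_zero_left, hA.braces_zero_right, hM] at h
  simp only [recast_zero, smul_zero, sub_zero] at h
  rw [hm.M1_smul, mul_smul, ← h, cup, cup, cup, hA.gbr_smul, recast_smul k V (by ring),
    recast_smul k V (by ring), recast_smul k V (by ring), smul_sub, smul_sub, add_sub_assoc a,
    negOne_zpow_add k a, mul_smul, smul_comm ((-1 : k) ^ (b - 1)) ((-1 : k) ^ a),
    smul_comm ((-1 : k) ^ (b - 1)) ((-1 : k) ^ (a * (b + 1)))]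

end Scalars

/-- For an `A∞`-structure `m` and homogeneous `A,B,C ∈ W`, the cochain
identity behind the graded Poisson relation holds:
`[A,M₂(B,C)] − (−1)^{|A|}M₂([A,B],C) − (−1)^{|A|(|B|+1)}M₂(B,[A,C])`
`= (−1)^{|A|}(M₁(A{B,C}) − M₁(A){B,C} − (−1)^{|A|}A{M₁(B),C} − (−1)^{|A|+|B|}A{B,M₁(C)})`;
in particular, for `M₁`-cocycles `A,B,C` the left-hand side is an `M₁`-coboundary, so on
`M₁`-cohomology the cup product and the induced Gerstenhaber bracket satisfy
`[a, b∪c] = [a,b]∪c + (−1)^{|a|(|b|+1)} b∪[a,c]`. -/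
theorem gerstenhaber_poisson_relation (m : E V 1) (hm : IsMultilinear k V m)
    (hmc : gcomp k V m m = 0) (a b c : ℤ) (A : E V a) (B : E V b) (C : E V c)
    (hA : IsMultilinear k V A) (hB : IsMultilinear k V B) (hC : IsMultilinear k V C) :
    ((recast V (gbr k V A (M2 k V m B C)) : E V (a + b + c + 1)) -
        ((-1 : k) ^ a) • recast V (M2 k V m (gbr k V A B) C) -
        ((-1 : k) ^ (a * (b + 1))) • recast V (M2 k V m B (gbr k V A C)) =
      ((-1 : k) ^ a) •
        (recast V (M1 k V m (recast V (braces k V A [⟨b, B⟩, ⟨c, C⟩]) : E V (a + b + c))) -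
          recast V (braces k V (M1 k V m A) [⟨b, B⟩, ⟨c, C⟩]) -
          ((-1 : k) ^ a) • recast V (braces k V A [⟨b + 1, M1 k V m B⟩, ⟨c, C⟩]) -
          ((-1 : k) ^ (a + b)) • recast V (braces k V A [⟨b, B⟩, ⟨c + 1, M1 k V m C⟩]))) ∧
    (M1 k V m A = 0 → M1 k V m B = 0 → M1 k V m C = 0 →
      ∃ R : E V (a + b + c), IsMultilinear k V R ∧
        (recast V (gbr k V A (cup k V m B C)) : E V (a + b + c + 1)) -
            recast V (cup k V m (gbr k V A B) C) -
            ((-1 : k) ^ (a * (b + 1))) • recast V (cup k V m B (gbr k V A C)) =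
          M1 k V m R) := by
  refine ⟨gbr_M2_cochain_identity hm B C hA, fun hA₀ hB₀ hC₀ => ⟨_, ?_,
    gbr_cup_of_cocycles hm hA hA₀ hB₀ hC₀⟩⟩
  exact ((hA.braces_pair k V hB hC).recast k V (by simp [degl, add_assoc])).smul k V _

end Ainf
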